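/- Fix 0 < c < 1 and define f_c(θ) = π·F_c(θ/π + 1/2) − π/2 and g_c(θ) = −f_c(−θ) for θ ∈ [−π/2, π/2]. Define P_c : S² → ℝ on the unit sphere S² ⊂ ℝ³ by P_c(u) = (u₁² cos²f_c(θ) sin f_c(θ) + u₂² cos²g_c(θ) sin g_c(θ)) / (u₁² cos²f_c(θ) + u₂² cos²g_c(θ)) with θ = arcsin u₃ whenever u₁² + u₂² > 0, and P_c(0,0,1) = 1, P_c(0,0,−1) = −1. Then P_c is a C²-function on the smooth manifold S² (twice continuously differentiable with respect to the standard smooth structure on the sphere). (This is Lemma 4.5: in spherical coordinates u = (cos θ cos φ, cos θ sin φ, sin θ), P_c coincides with ρ_c(θ, φ), so the radial function R_{c,d} = R(1 + d·P_c) of the body K(c,d) is C²-class differentiable for all 0 < d < 1.) -/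

import Mathlib

open Real
open scoped Manifold

/-- The function `F_c` of the Várkonyi–Domokos construction. -/
noncomputable def Fc (c x : ℝ) : ℝ :=
  (c * x^2 + (1 - c) * (1 - x)^2 * (c * x / (c + x))) / (c * x + (1 - c) * (1 - x)^2)

noncomputable def fc (c θ : ℝ) : ℝ := π * Fc c (θ / π + 1/2) - π / 2

noncomputable def gc (c θ : ℝ) : ℝ := - fc c (-θ)

open Classical in
/-- The function `ρ_c` expressed as a function `P_c` of the unit vector
`u = (cos θ cos φ, cos θ sin φ, sin θ)`. -/
noncomputable def Pc (c : ℝ) (u : EuclideanSpace ℝ (Fin 3)) : ℝ :=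
  if 0 < (u 0)^2 + (u 1)^2 then
    ((u 0)^2 * cos (fc c (arcsin (u 2)))^2 * sin (fc c (arcsin (u 2))) +
     (u 1)^2 * cos (gc c (arcsin (u 2)))^2 * sin (gc c (arcsin (u 2)))) /
    ((u 0)^2 * cos (fc c (arcsin (u 2)))^2 +
     (u 1)^2 * cos (gc c (arcsin (u 2)))^2)
  else if 0 < u 2 then 1 else -1

instance : Fact (Module.finrank ℝ (EuclideanSpace ℝ (Fin 3)) = 2 + 1) :=
  ⟨by simp⟩

theorem eventually_norm_sphere {E : Type*} [NormedAddCommGroup E] [InnerProductSpace ℝ E]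
    [ProperSpace E] {p : ℝ × E → Prop} (hp : ∀ v, ‖v‖ = 1 → ∀ᶠ z in nhds ((0 : ℝ), v), p z) :
    ∀ᶠ x in nhds (0 : E), x ≠ 0 → p (‖x‖, ‖x‖⁻¹ • x) := by
  have h : ∀ᶠ s in nhds (0 : ℝ), ∀ v ∈ Metric.sphere (0 : E) 1, p (s, v) := by
    apply IsCompact.eventually_forall_of_forall_eventually (isCompact_sphere (0 : E) 1)
    intro v hv
    exact hp v (by simpa using hv)
  have h0 : Filter.Tendsto (fun x : E => ‖x‖) (nhds 0) (nhds 0) := by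
    simpa using (continuous_norm (E := E)).tendsto 0
  filter_upwards [h0.eventually h] with x hx hx0
  apply hx
  simp [norm_smul, hx0]

theorem norm_pow_smul_isBigO {E F : Type*} [NormedAddCommGroup E] [InnerProductSpace ℝ E]
    [ProperSpace E] [NormedAddCommGroup F] [NormedSpace ℝ F] {H : ℝ × E → F}
    (hH : ∀ v, ‖v‖ = 1 → ContinuousAt H (0, v)) {k : ℕ} (hk : k ≠ 0) :
    (fun x : E => ‖x‖ ^ k • H (‖x‖, ‖x‖⁻¹ • x)) =O[nhds 0] fun x => ‖x‖ ^ k := by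
  obtain ⟨C, hC⟩ := (isCompact_sphere (0 : E) 1).exists_bound_of_continuousOn
    (f := fun v => H (0, v)) fun v hv =>
      ((hH v (by simpa using hv)).comp (f := fun v : E => ((0 : ℝ), v))
        (by fun_prop)).continuousWithinAt
  have h := eventually_norm_sphere (E := E) (p := fun z => ‖H z‖ < C + 1) fun v hv =>
    (hH v hv).norm.eventually_lt_const
      (show ‖H (0, v)‖ < C + 1 by linarith [hC v (by simpa using hv)])
  refine Asymptotics.IsBigO.of_bound (C + 1) ?_
  filter_upwards [h] with x hx
  rcases eq_or_ne x 0 with rfl | hx0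
  · simp [hk]
  · rw [norm_smul, mul_comm]
    gcongr
    exact (hx hx0).le

theorem hasFDerivAt_norm {E : Type*} [NormedAddCommGroup E] [InnerProductSpace ℝ E] {x : E}
    (hx : x ≠ 0) : HasFDerivAt (fun y : E => ‖y‖) (innerSL ℝ (‖x‖⁻¹ • x)) x := by
  have h := (hasStrictFDerivAt_norm_sq x).hasFDerivAt.sqrt (by simpa using hx)
  simp only [Real.sqrt_sq (norm_nonneg _)] at h
  convert h using 1
  ext y
  have : ‖x‖ ≠ 0 := by simpa using hx
  simp
  field_simp

/-- The angular factor of the derivative of `x ↦ ‖x‖ ^ (k + 1) • H (‖x‖, ‖x‖⁻¹ • x)`. -/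
noncomputable def polarDeriv {E F : Type*} [NormedAddCommGroup E] [InnerProductSpace ℝ E]
    [NormedAddCommGroup F] [NormedSpace ℝ F] (k : ℕ) (H : ℝ × E → F) (z : ℝ × E) : E →L[ℝ] F :=
  ((k : ℝ) + 1) • (innerSL ℝ z.2).smulRight (H z) +
    (fderiv ℝ H z) ∘L (ContinuousLinearMap.inl ℝ ℝ E ∘L (z.1 • innerSL ℝ z.2) +
      ContinuousLinearMap.inr ℝ ℝ E ∘L
        (ContinuousLinearMap.id ℝ E - (innerSL ℝ z.2).smulRight z.2))

theorem hasFDerivAt_norm_pow_smul {E F : Type*} [NormedAddCommGroup E] [InnerProductSpace ℝ E]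
    [NormedAddCommGroup F] [NormedSpace ℝ F] {H : ℝ × E → F} (k : ℕ) {x : E} (hx : x ≠ 0)
    (hH : DifferentiableAt ℝ H (‖x‖, ‖x‖⁻¹ • x)) :
    HasFDerivAt (fun x : E => ‖x‖ ^ (k + 1) • H (‖x‖, ‖x‖⁻¹ • x))
      (‖x‖ ^ k • polarDeriv k H (‖x‖, ‖x‖⁻¹ • x)) x := by
  have hr : ‖x‖ ≠ 0 := by simpa using hx
  have h1 := hasFDerivAt_norm hx
  have h2 := (hasDerivAt_inv hr).comp_hasFDerivAt x h1
  have h3 := h2.smul (hasFDerivAt_id x)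
  have h4 := hH.hasFDerivAt.comp x (h1.prodMk h3)
  have h5 := (h1.pow (k + 1)).smul h4
  refine h5.congr_fderiv ?_
  ext y
  have key : ContinuousLinearMap.inl ℝ ℝ E (‖x‖ • innerSL ℝ (‖x‖⁻¹ • x) y) +
      ContinuousLinearMap.inr ℝ ℝ E (y - innerSL ℝ (‖x‖⁻¹ • x) y • ‖x‖⁻¹ • x) =
      ‖x‖ • (innerSL ℝ (‖x‖⁻¹ • x) y,
        ‖x‖⁻¹ • y + (-(‖x‖ ^ 2)⁻¹ • innerSL ℝ (‖x‖⁻¹ • x) y) • x) := by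
    generalize innerSL ℝ (‖x‖⁻¹ • x) y = t
    ext
    · simp
    · simp only [ContinuousLinearMap.inl_apply, ContinuousLinearMap.inr_apply, Prod.mk_add_mk,
        Prod.smul_mk, zero_add, smul_eq_mul]
      match_scalars <;> field_simp
  change ‖x‖ ^ (k + 1) • fderiv ℝ H (‖x‖, ‖x‖⁻¹ • x) (innerSL ℝ (‖x‖⁻¹ • x) y,
        ‖x‖⁻¹ • y + (-(‖x‖ ^ 2)⁻¹ • innerSL ℝ (‖x‖⁻¹ • x) y) • x) +
      (((k + 1) • ‖x‖ ^ k) • innerSL ℝ (‖x‖⁻¹ • x) y) • H (‖x‖, ‖x‖⁻¹ • x) =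
    ‖x‖ ^ k • (((k : ℝ) + 1) • innerSL ℝ (‖x‖⁻¹ • x) y • H (‖x‖, ‖x‖⁻¹ • x) +
      fderiv ℝ H (‖x‖, ‖x‖⁻¹ • x)
        (ContinuousLinearMap.inl ℝ ℝ E (‖x‖ • innerSL ℝ (‖x‖⁻¹ • x) y) +
          ContinuousLinearMap.inr ℝ ℝ E (y - innerSL ℝ (‖x‖⁻¹ • x) y • ‖x‖⁻¹ • x)))
  rw [key, (fderiv ℝ H (‖x‖, ‖x‖⁻¹ • x)).map_smul]
  generalize fderiv ℝ H (‖x‖, ‖x‖⁻¹ • x) _ = D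
  generalize H (‖x‖, ‖x‖⁻¹ • x) = h
  generalize innerSL ℝ (‖x‖⁻¹ • x) y = t
  simp only [nsmul_eq_mul, smul_eq_mul, Nat.cast_add, Nat.cast_one]
  module

/-- A function of the form `r ^ k • H (r, v)` in polar coordinates is `C^n` at the origin when
`n < k` and `H` is `C^n` along `{0} × sphere`. -/
theorem contDiffAt_norm_pow_smul.{u} {E F : Type u} [NormedAddCommGroup E]
    [InnerProductSpace ℝ E] [ProperSpace E] [NormedAddCommGroup F] [NormedSpace ℝ F] {n k : ℕ} (hk : n < k) {H : ℝ × E → F}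
    (hH : ∀ v, ‖v‖ = 1 → ContDiffAt ℝ n H (0, v)) :
    ContDiffAt ℝ n (fun x : E => ‖x‖ ^ k • H (‖x‖, ‖x‖⁻¹ • x)) 0 := by
  induction n generalizing k F with
  | zero =>
    have hev := eventually_norm_sphere fun v hv => (hH v hv).eventually (by simp)
    have hO := norm_pow_smul_isBigO (fun v hv => (hH v hv).continuousAt) hk.ne'
    refine contDiffAt_zero.2 ⟨_, hev, fun x hx => ContinuousAt.continuousWithinAt ?_⟩
    rcases eq_or_ne x 0 with rfl | hx0
    · have : Filter.Tendsto (fun x : E => ‖x‖ ^ k) (nhds 0) (nhds 0) := by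
        have : Continuous fun x : E => ‖x‖ ^ k := by fun_prop
        simpa [hk.ne'] using this.tendsto 0
      simpa [ContinuousAt, hk.ne'] using hO.trans_tendsto this
    · have hr : ‖x‖ ≠ 0 := by simpa using hx0
      have h1 : ContinuousAt (fun x : E => (‖x‖, ‖x‖⁻¹ • x)) x := by fun_prop (disch := assumption)
      have h2 := ContinuousAt.comp (f := fun x : E => (‖x‖, ‖x‖⁻¹ • x)) (x := x) (hx hx0).continuousAt h1
      exact (by fun_prop : ContinuousAt (fun x : E => ‖x‖ ^ k) x).smul h2
  | succ n ih =>
    obtain ⟨k, rfl⟩ : ∃ m, k = m + 1 := ⟨k - 1, by omega⟩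
    have hev := eventually_norm_sphere fun v hv => (hH v hv).eventually (by simp)
    have hO := norm_pow_smul_isBigO (fun v hv => (hH v hv).continuousAt) hk.ne_bot
    push_cast
    refine contDiffAt_succ_iff_hasFDerivAt.2
      ⟨fun x => ‖x‖ ^ k • polarDeriv k H (‖x‖, ‖x‖⁻¹ • x), ⟨_, hev, fun x hx => ?_⟩, ?_⟩
    · rcases eq_or_ne x 0 with rfl | hx0
      · have : k ≠ 0 := by omega
        have h := Asymptotics.IsBigO.hasFDerivAt (𝕜 := ℝ) (x₀ := (0 : E)) (n := k + 1) (by simpa using hO) (by omega)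
        simpa [this] using h
      · exact hasFDerivAt_norm_pow_smul k hx0 ((hx hx0).differentiableAt (by simp))
    · refine ih (by omega) fun v hv => ?_
      have h := hH v hv
      have h1 : ContDiffAt ℝ n H (0, v) := h.of_le (by norm_cast; omega)
      have h2 : ContDiffAt ℝ n (fderiv ℝ H) (0, v) := h.fderiv_right (by norm_cast)
      have h3 : ContDiffAt ℝ n (fun z : ℝ × E => innerSL ℝ z.2) (0, v) :=
        (innerSL ℝ (E := E)).contDiff.contDiffAt.comp _ contDiffAt_snd
      have h4 : ContDiffAt ℝ n (fun z : ℝ × E => z.1 • innerSL ℝ z.2) (0, v) :=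
        contDiffAt_fst.smul h3
      have h5 : ContDiffAt ℝ n (fun z : ℝ × E =>
          ContinuousLinearMap.id ℝ E - (innerSL ℝ z.2).smulRight z.2) (0, v) :=
        contDiffAt_const.sub (h3.smulRight contDiffAt_snd)
      exact ((h3.smulRight h1).const_smul _).add (h2.clm_comp
        ((contDiffAt_const.clm_comp h4).add (contDiffAt_const.clm_comp h5)))

theorem exists_sin_cos_arcsin_factor {a : ℝ → ℝ} (ha : AnalyticAt ℝ a 0) :
    ∃ p q : ℝ → ℝ, AnalyticAt ℝ p 0 ∧ AnalyticAt ℝ q 0 ∧ p 0 = 1 ∧ ∀ᶠ s in nhds (0 : ℝ),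
      cos (π / 2 - arcsin s - arcsin s ^ 2 * a (arcsin s)) = s * p s ∧
      sin (π / 2 - arcsin s - arcsin s ^ 2 * a (arcsin s)) = cos (arcsin s) + s ^ 3 * q s := by
  have factor : ∀ f : ℝ → ℝ, AnalyticAt ℝ f 0 → f 0 = 0 → HasDerivAt f 1 0 →
      ∃ g : ℝ → ℝ, AnalyticAt ℝ g 0 ∧ g 0 = 1 ∧ ∀ᶠ s in nhds (0 : ℝ), f s = s * g s := by
    intro f hf h0 hd
    obtain ⟨P, hP⟩ := hf
    refine ⟨dslope f 0, ⟨_, hP.has_fpower_series_dslope_fslope⟩, by simp [hd.deriv], .of_forall fun s => ?_⟩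
    have := sub_smul_dslope f 0 s
    simp [h0] at this
    exact this.symm
  obtain ⟨S, hS, hS0, hSe⟩ := factor sin (by fun_prop) (by simp) (by simpa using hasDerivAt_sin 0)
  have hasA : AnalyticAt ℝ arcsin 0 := (contDiffAt_arcsin (by norm_num) (by norm_num)).analyticAt
  obtain ⟨A, hA, hA0, hAe⟩ := factor arcsin hasA (by simp)
    (by simpa using hasDerivAt_arcsin (x := 0) (by norm_num) (by norm_num))
  let u : ℝ → ℝ := fun s => arcsin s + arcsin s ^ 2 * a (arcsin s)
  let w : ℝ → ℝ := fun s => arcsin s + arcsin s ^ 2 * a (arcsin s) / 2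
  let z : ℝ → ℝ := fun s => arcsin s ^ 2 * a (arcsin s) / 2
  have haA : AnalyticAt ℝ (fun s => a (arcsin s)) 0 := by
    apply AnalyticAt.fun_comp _ hasA
    simpa using ha
  have hu : AnalyticAt ℝ u 0 := hasA.add ((hasA.pow 2).mul haA)
  have hz : AnalyticAt ℝ z 0 := ((hasA.pow 2).mul haA).div analyticAt_const two_ne_zero
  have hw : AnalyticAt ℝ w 0 := hasA.add hz
  have hu0 : u 0 = 0 := by simp [u]
  have hw0 : w 0 = 0 := by simp [w]
  have hz0 : z 0 = 0 := by simp [z]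
  have comp : ∀ v : ℝ → ℝ, AnalyticAt ℝ v 0 → v 0 = 0 →
      AnalyticAt ℝ (fun s => S (v s)) 0 ∧ ∀ᶠ s in nhds (0 : ℝ), sin (v s) = v s * S (v s) := by
    intro v hv hv0
    refine ⟨AnalyticAt.fun_comp (by rwa [hv0]) hv, ?_⟩
    have h := hv.continuousAt.tendsto
    rw [hv0] at h
    exact h.eventually hSe
  obtain ⟨hSu, hue⟩ := comp u hu hu0
  obtain ⟨hSw, hwe⟩ := comp w hw hw0
  obtain ⟨hSz, hze⟩ := comp z hz hz0
  refine ⟨fun s => A s * (1 + arcsin s * a (arcsin s)) * S (u s),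
    fun s => -(A s ^ 3 * a (arcsin s) * (1 + arcsin s * a (arcsin s) / 2) * S (w s) * S (z s)),
    (hA.mul (analyticAt_const.add (hasA.mul haA))).mul hSu,
    (((((hA.pow 3).mul haA).mul (analyticAt_const.add
      ((hasA.mul haA).div analyticAt_const two_ne_zero))).mul hSw).mul hSz).neg, by simp [hA0, hu0, hS0], ?_⟩
  filter_upwards [hue, hwe, hze, hAe] with s h1 h2 h3 h4
  constructor
  · rw [show π / 2 - arcsin s - arcsin s ^ 2 * a (arcsin s) = π / 2 - u s by simp only [u]; ring,
      cos_pi_div_two_sub, h1]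
    simp only [u]
    linear_combination (1 + arcsin s * a (arcsin s)) * S (u s) * h4
  · rw [show π / 2 - arcsin s - arcsin s ^ 2 * a (arcsin s) = π / 2 - (w s + z s) by
      simp only [w, z]; ring, sin_pi_div_two_sub]
    have h5 : cos (arcsin s) = cos (w s - z s) := by simp only [w, z]; ring_nf
    rw [h5, cos_add, cos_sub, h2, h3]
    have h6 : w s * z s = arcsin s ^ 3 * (a (arcsin s) / 2 * (1 + arcsin s * a (arcsin s) / 2)) := by
      simp only [w, z]; ring
    have h7 : arcsin s ^ 3 = s ^ 3 * A s ^ 3 := by rw [h4]; ring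
    linear_combination (-2 * S (w s) * S (z s)) * h6 +
      (-2 * S (w s) * S (z s)) * (a (arcsin s) / 2 * (1 + arcsin s * a (arcsin s) / 2)) * h7

theorem Fc_eq {c x : ℝ} (h1 : c + x ≠ 0) (h2 : c * x + (1 - c) * (1 - x) ^ 2 ≠ 0) :
    Fc c x = x - x ^ 2 * (1 - x) ^ 2 *
      ((1 - c) / ((c + x) * (c * x + (1 - c) * (1 - x) ^ 2))) := by
  unfold Fc
  rw [div_eq_iff h2]
  field_simp
  ring

theorem exists_fc_pi_div_two_sub {c : ℝ} (hc0 : 0 < c) : ∃ a : ℝ → ℝ, AnalyticAt ℝ a 0 ∧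
    ∀ᶠ t in nhds (0 : ℝ), fc c (π / 2 - t) = π / 2 - t - t ^ 2 * a t := by
  have hπ := pi_ne_zero
  have h1 : ∀ᶠ t in nhds (0 : ℝ), c + (1 - t / π) ≠ 0 :=
    ContinuousAt.eventually_ne (g := fun t => c + (1 - t / π)) (by fun_prop)
      (by simp; linarith)
  have h2 : ∀ᶠ t in nhds (0 : ℝ), c * (1 - t / π) + (1 - c) * (1 - (1 - t / π)) ^ 2 ≠ 0 :=
    ContinuousAt.eventually_ne
      (g := fun t => c * (1 - t / π) + (1 - c) * (1 - (1 - t / π)) ^ 2) (by fun_prop)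
      (by simp; linarith)
  refine ⟨fun t => (1 - t / π) ^ 2 / π * ((1 - c) / ((c + (1 - t / π)) *
    (c * (1 - t / π) + (1 - c) * (1 - (1 - t / π)) ^ 2))), ?_, ?_⟩
  · have := mul_ne_zero h1.self_of_nhds h2.self_of_nhds
    fun_prop (disch := assumption)
  · filter_upwards [h1, h2] with t h1 h2
    unfold fc
    rw [show (π / 2 - t) / π + 1 / 2 = 1 - t / π by field_simp; ring, Fc_eq h1 h2]
    generalize (1 - c) / ((c + (1 - t / π)) *
      (c * (1 - t / π) + (1 - c) * (1 - (1 - t / π)) ^ 2)) = K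
    field_simp
    ring

theorem exists_gc_pi_div_two_sub {c : ℝ} (hc0 : 0 < c) (hc1 : c < 1) :
    ∃ a : ℝ → ℝ, AnalyticAt ℝ a 0 ∧
      ∀ᶠ t in nhds (0 : ℝ), gc c (π / 2 - t) = π / 2 - t - t ^ 2 * a t := by
  have hπ := pi_ne_zero
  have h1 : ∀ᶠ t in nhds (0 : ℝ), c + t / π ≠ 0 :=
    ContinuousAt.eventually_ne (g := fun t => c + t / π) (by fun_prop)
      (by simp; linarith)
  have h2 : ∀ᶠ t in nhds (0 : ℝ), c * (t / π) + (1 - c) * (1 - t / π) ^ 2 ≠ 0 :=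
    ContinuousAt.eventually_ne
      (g := fun t => c * (t / π) + (1 - c) * (1 - t / π) ^ 2) (by fun_prop)
      (by simp; linarith)
  refine ⟨fun t => -((1 - t / π) ^ 2 / π * ((1 - c) / ((c + t / π) *
    (c * (t / π) + (1 - c) * (1 - t / π) ^ 2)))), ?_, ?_⟩
  · have := mul_ne_zero h1.self_of_nhds h2.self_of_nhds
    fun_prop (disch := assumption)
  · filter_upwards [h1, h2] with t h1 h2
    unfold gc fc
    rw [show -(π / 2 - t) / π + 1 / 2 = t / π by field_simp; ring, Fc_eq h1 h2]
    generalize (1 - c) / ((c + t / π) *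
      (c * (t / π) + (1 - c) * (1 - t / π) ^ 2)) = K
    field_simp
    ring

theorem exists_contDiffAt_Pc_north {c : ℝ} (hc0 : 0 < c) (hc1 : c < 1)
    {N : EuclideanSpace ℝ (Fin 3)} (hN0 : N 0 = 0) (hN1 : N 1 = 0) (hN2 : N 2 = 1) :
    ∃ Q : EuclideanSpace ℝ (Fin 3) → ℝ, ContDiffAt ℝ 2 Q N ∧
      ∀ᶠ u in nhds N, ‖u‖ = 1 → Pc c u = Q u := by
  obtain ⟨a, ha, hfa⟩ := exists_fc_pi_div_two_sub hc0
  obtain ⟨b, hb, hgb⟩ := exists_gc_pi_div_two_sub hc0 hc1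
  obtain ⟨p₁, q₁, hp₁, hq₁, hp₁0, h₁⟩ := exists_sin_cos_arcsin_factor ha
  obtain ⟨p₂, q₂, hp₂, hq₂, hp₂0, h₂⟩ := exists_sin_cos_arcsin_factor hb
  have harc : Filter.Tendsto arcsin (nhds 0) (nhds 0) := by
    simpa using continuous_arcsin.tendsto 0
  have hne₁ : ∀ᶠ s in nhds 0, p₁ s ≠ 0 := hp₁.continuousAt.eventually_ne (by simp [hp₁0])
  have hne₂ : ∀ᶠ s in nhds 0, p₂ s ≠ 0 := hp₂.continuousAt.eventually_ne (by simp [hp₂0])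
  let H : ℝ × EuclideanSpace ℝ (Fin 2) → ℝ := fun z =>
    ((z.2 0) ^ 2 * p₁ z.1 ^ 2 * q₁ z.1 + (z.2 1) ^ 2 * p₂ z.1 ^ 2 * q₂ z.1) /
      ((z.2 0) ^ 2 * p₁ z.1 ^ 2 + (z.2 1) ^ 2 * p₂ z.1 ^ 2)
  have hH : ∀ v, ‖v‖ = 1 → ContDiffAt ℝ (2 : ℕ) H (0, v) := by
    intro v hv
    have lift : ∀ f : ℝ → ℝ, AnalyticAt ℝ f 0 →
        ContDiffAt ℝ (2 : ℕ) (fun z : ℝ × EuclideanSpace ℝ (Fin 2) => f z.1) (0, v) :=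
      fun f hf => ContDiffAt.comp (g := f) _ hf.contDiffAt contDiffAt_fst
    have coord : ∀ i, ContDiffAt ℝ (2 : ℕ)
        (fun z : ℝ × EuclideanSpace ℝ (Fin 2) => z.2 i) (0, v) := fun i =>
      ContDiffAt.comp (g := fun w : EuclideanSpace ℝ (Fin 2) => w i) _
        (by fun_prop) contDiffAt_snd
    have e0 := ((coord 0).pow 2).mul ((lift p₁ hp₁).pow 2)
    have e1 := ((coord 1).pow 2).mul ((lift p₂ hp₂).pow 2)
    refine ((e0.mul (lift q₁ hq₁)).add (e1.mul (lift q₂ hq₂))).div (e0.add e1) ?_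
    have : v 0 ^ 2 + v 1 ^ 2 = 1 := by
      have := EuclideanSpace.real_norm_sq_eq v
      rw [hv, Fin.sum_univ_two] at this
      linarith
    simp [hp₁0, hp₂0, this]
  let pr : EuclideanSpace ℝ (Fin 3) → EuclideanSpace ℝ (Fin 2) := fun u => !₂[u 0, u 1]
  have hpr : ContDiff ℝ 2 pr := by
    rw [contDiff_euclidean]
    intro i
    fin_cases i
    · simp only [pr]; simp; fun_prop
    · simp only [pr]; simp; fun_prop
  have hprN : pr N = 0 := by
    ext i
    fin_cases i <;> simp [pr, hN0, hN1]
  refine ⟨fun u => u 2 + ‖pr u‖ ^ 3 • H (‖pr u‖, ‖pr u‖⁻¹ • pr u), ?_, ?_⟩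
  · have h := contDiffAt_norm_pow_smul (n := 2) (k := 3) (by norm_num) hH
    rw [← hprN] at h
    exact ContDiffAt.add (by fun_prop) (h.comp N hpr.contDiffAt)
  · have hs : Filter.Tendsto (fun u => ‖pr u‖) (nhds N) (nhds 0) := by
      simpa [hprN] using (hpr.continuous.norm).tendsto N
    have hpos : ∀ᶠ u in nhds N, 0 < u 2 :=
      ContinuousAt.eventually_lt (f := fun _ => (0 : ℝ)) (by fun_prop) (by fun_prop)
        (by simp [hN2])
    filter_upwards [hs.eventually hne₁, hs.eventually hne₂, hs.eventually h₁, hs.eventually h₂,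
      hs.eventually (harc.eventually hfa), hs.eventually (harc.eventually hgb), hpos]
      with u hne₁ hne₂ h₁ h₂ hfa hgb hpos hu
    have hsq : ‖pr u‖ ^ 2 = u 0 ^ 2 + u 1 ^ 2 := by
      rw [EuclideanSpace.real_norm_sq_eq, Fin.sum_univ_two]
      simp [pr]
    have hsum : u 0 ^ 2 + u 1 ^ 2 + u 2 ^ 2 = 1 := by
      have := EuclideanSpace.real_norm_sq_eq u
      rw [hu, Fin.sum_univ_three] at this
      linarith
    set s := ‖pr u‖ with hs_def
    have hs0 : 0 ≤ s := norm_nonneg _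
    have hcos : cos (arcsin s) = u 2 := by
      rw [cos_arcsin, show 1 - s ^ 2 = u 2 ^ 2 by linarith, sqrt_sq hpos.le]
    have harcsin : arcsin (u 2) = π / 2 - arcsin s := by
      rw [← hcos, ← sin_pi_div_two_sub, arcsin_sin]
      · linarith [arcsin_le_pi_div_two s, pi_pos]
      · linarith [arcsin_nonneg.2 hs0]
    unfold Pc
    rw [← hsq, harcsin, hfa, hgb, h₁.1, h₁.2, h₂.1, h₂.2, hcos]
    rcases hs0.eq_or_lt with h0 | h0
    · have : u 2 = 1 := by rw [← hcos, ← h0]; simp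
      simp [← h0, this]
    · rw [if_pos (by positivity)]
      have e0 : u 0 = s * (s⁻¹ • pr u) 0 := by simp [pr]; field_simp
      have e1 : u 1 = s * (s⁻¹ • pr u) 1 := by simp [pr]; field_simp
      simp only [H]
      rw [e0, e1] at hsq ⊢
      generalize (s⁻¹ • pr u) 0 = x at *
      generalize (s⁻¹ • pr u) 1 = y at *
      have hxy : x ^ 2 + y ^ 2 = 1 := by
        have : s ^ 2 * (x ^ 2 + y ^ 2 - 1) = 0 := by linarith
        have := (mul_eq_zero.1 this).resolve_left (by positivity)
        linarith
      have hD : 0 < x ^ 2 * p₁ s ^ 2 + y ^ 2 * p₂ s ^ 2 := by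
        rcases eq_or_ne x 0 with rfl | hx
        · have : y ≠ 0 := by rintro rfl; norm_num at hxy
          positivity
        · positivity
      have hD' : (s * x) ^ 2 * (s * p₁ s) ^ 2 + (s * y) ^ 2 * (s * p₂ s) ^ 2 ≠ 0 := by
        have : 0 < s ^ 4 * (x ^ 2 * p₁ s ^ 2 + y ^ 2 * p₂ s ^ 2) := by positivity
        nlinarith
      rw [div_eq_iff hD', smul_eq_mul]
      field_simp
      ring

theorem Pc_swap_neg (c : ℝ) {u w : EuclideanSpace ℝ (Fin 3)} (h0 : w 0 = u 1) (h1 : w 1 = u 0)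
    (h2 : w 2 = -u 2) (hu : u 2 ≠ 0) : Pc c u = -Pc c w := by
  unfold Pc
  rw [h0, h1, h2, arcsin_neg, add_comm (u 1 ^ 2)]
  have e : fc c (arcsin (u 2)) = -gc c (-arcsin (u 2)) := by simp [gc]
  have e' : fc c (-arcsin (u 2)) = -gc c (arcsin (u 2)) := by simp [gc]
  split_ifs with ha hb hc hd
  · rw [e, e']
    simp only [cos_neg, sin_neg]
    rw [← neg_div]
    congr 1 <;> ring
  · linarith
  · simp
  · simp
  · exact absurd (le_antisymm (not_lt.1 hb) (by linarith)) hu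

theorem Fc_mem_Ioo {c x : ℝ} (hc0 : 0 < c) (hc1 : c < 1) (hx : x ∈ Set.Ioo (0 : ℝ) 1) :
    Fc c x ∈ Set.Ioo (0 : ℝ) 1 := by
  obtain ⟨h0, h1⟩ := hx
  have hc : 0 < 1 - c := by linarith
  have hx : 0 < 1 - x := by linarith
  constructor
  · unfold Fc
    positivity
  · rw [Fc_eq (by positivity) (by positivity)]
    have : 0 < x ^ 2 * (1 - x) ^ 2 *
      ((1 - c) / ((c + x) * (c * x + (1 - c) * (1 - x) ^ 2))) := by positivity
    linarith

theorem div_pi_add_half_mem_Ioo {θ : ℝ} (hθ : θ ∈ Set.Ioo (-(π / 2)) (π / 2)) :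
    θ / π + 1 / 2 ∈ Set.Ioo (0 : ℝ) 1 := by
  have hπ := pi_pos
  constructor
  · have : -(1 / 2) < θ / π := by rw [lt_div_iff₀ hπ]; linarith [hθ.1]
    linarith
  · have : θ / π < 1 / 2 := by rw [div_lt_iff₀ hπ]; linarith [hθ.2]
    linarith

theorem cos_fc_pos {c θ : ℝ} (hc0 : 0 < c) (hc1 : c < 1) (hθ : θ ∈ Set.Ioo (-(π / 2)) (π / 2)) :
    0 < cos (fc c θ) := by
  have h := Fc_mem_Ioo hc0 hc1 (div_pi_add_half_mem_Ioo hθ)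
  apply cos_pos_of_mem_Ioo
  unfold fc
  constructor <;> nlinarith [h.1, h.2, pi_pos]

theorem contDiffAt_fc {c θ : ℝ} (hc0 : 0 < c) (hc1 : c < 1)
    (hθ : θ ∈ Set.Ioo (-(π / 2)) (π / 2)) : ContDiffAt ℝ 2 (fc c) θ := by
  obtain ⟨h0, h1⟩ := div_pi_add_half_mem_Ioo hθ
  have hF : ∀ x ∈ Set.Ioo (0 : ℝ) 1, ContDiffAt ℝ 2 (Fc c) x := by
    rintro x ⟨h0, h1⟩
    have hc : 0 < 1 - c := by linarith
    have hx : 0 < 1 - x := by linarith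
    have d1 : c + x ≠ 0 := by positivity
    have d2 : c * x + (1 - c) * (1 - x) ^ 2 ≠ 0 := by positivity
    unfold Fc
    fun_prop (disch := assumption)
  have := ContDiffAt.comp (g := Fc c) (f := fun θ => θ / π + 1 / 2) θ (hF _ ⟨h0, h1⟩) (by fun_prop)
  exact (contDiffAt_const.mul this).sub contDiffAt_const

theorem contDiffAt_Pc {c : ℝ} (hc0 : 0 < c) (hc1 : c < 1) {u : EuclideanSpace ℝ (Fin 3)}
    (hu : 0 < u 0 ^ 2 + u 1 ^ 2) (h1 : -1 < u 2) (h2 : u 2 < 1) : ContDiffAt ℝ 2 (Pc c) u := by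
  have hθ : arcsin (u 2) ∈ Set.Ioo (-(π / 2)) (π / 2) :=
    ⟨neg_pi_div_two_lt_arcsin.2 h1, arcsin_lt_pi_div_two.2 h2⟩
  have hθ' : -arcsin (u 2) ∈ Set.Ioo (-(π / 2)) (π / 2) :=
    ⟨by linarith [hθ.2], by linarith [hθ.1]⟩
  have hcf := cos_fc_pos hc0 hc1 hθ
  have hcg : 0 < cos (gc c (arcsin (u 2))) := by
    rw [gc, cos_neg]
    exact cos_fc_pos hc0 hc1 hθ'
  have harc : ContDiffAt ℝ 2 (fun u : EuclideanSpace ℝ (Fin 3) => arcsin (u 2)) u :=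
    ContDiffAt.comp (g := arcsin) u (contDiffAt_arcsin h1.ne' h2.ne) (by fun_prop)
  have hf : ContDiffAt ℝ 2 (fun u : EuclideanSpace ℝ (Fin 3) => fc c (arcsin (u 2))) u :=
    ContDiffAt.comp (g := fc c) u (contDiffAt_fc hc0 hc1 hθ) harc
  have hg : ContDiffAt ℝ 2 (fun u : EuclideanSpace ℝ (Fin 3) => gc c (arcsin (u 2))) u :=
    (ContDiffAt.comp (g := fc c) u (contDiffAt_fc hc0 hc1 hθ') harc.neg).neg
  have hD : (u 0) ^ 2 * cos (fc c (arcsin (u 2))) ^ 2 +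
      (u 1) ^ 2 * cos (gc c (arcsin (u 2))) ^ 2 ≠ 0 := by
    rcases eq_or_ne (u 0) 0 with h | h
    · have : u 1 ≠ 0 := by
        intro h'
        simp [h, h'] at hu
      positivity
    · positivity
  have key : ContDiffAt ℝ 2 (fun u : EuclideanSpace ℝ (Fin 3) =>
    ((u 0)^2 * cos (fc c (arcsin (u 2)))^2 * sin (fc c (arcsin (u 2))) +
     (u 1)^2 * cos (gc c (arcsin (u 2)))^2 * sin (gc c (arcsin (u 2)))) /
    ((u 0)^2 * cos (fc c (arcsin (u 2)))^2 +
     (u 1)^2 * cos (gc c (arcsin (u 2)))^2)) u := by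
    have e0 : ContDiffAt ℝ 2 (fun u : EuclideanSpace ℝ (Fin 3) =>
        (u 0)^2 * cos (fc c (arcsin (u 2)))^2) u :=
      (show ContDiffAt ℝ 2 (fun u : EuclideanSpace ℝ (Fin 3) => (u 0)^2) u by fun_prop).mul
        (hf.cos.pow 2)
    have e1 : ContDiffAt ℝ 2 (fun u : EuclideanSpace ℝ (Fin 3) =>
        (u 1)^2 * cos (gc c (arcsin (u 2)))^2) u :=
      (show ContDiffAt ℝ 2 (fun u : EuclideanSpace ℝ (Fin 3) => (u 1)^2) u by fun_prop).mul
        (hg.cos.pow 2)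
    exact ((e0.mul hf.sin).add (e1.mul hg.sin)).div (e0.add e1) hD
  refine key.congr_of_eventuallyEq ?_
  have hpos : ∀ᶠ w in nhds u, 0 < w 0 ^ 2 + w 1 ^ 2 :=
    ContinuousAt.eventually_lt (f := fun _ => (0 : ℝ)) (by fun_prop) (by fun_prop) hu
  filter_upwards [hpos] with w hw
  rw [Pc, if_pos hw]

theorem exists_contDiffAt_Pc {c : ℝ} (hc0 : 0 < c) (hc1 : c < 1)
    {N : EuclideanSpace ℝ (Fin 3)} (hN : ‖N‖ = 1) :
    ∃ Q : EuclideanSpace ℝ (Fin 3) → ℝ, ContDiffAt ℝ 2 Q N ∧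
      ∀ᶠ u in nhds N, ‖u‖ = 1 → Pc c u = Q u := by
  have hsum : N 0 ^ 2 + N 1 ^ 2 + N 2 ^ 2 = 1 := by
    have := EuclideanSpace.real_norm_sq_eq N
    rw [hN, Fin.sum_univ_three] at this
    linarith
  rcases (by positivity : 0 ≤ N 0 ^ 2 + N 1 ^ 2).eq_or_lt with h | h
  · have h0 : N 0 = 0 := by nlinarith [sq_nonneg (N 0), sq_nonneg (N 1)]
    have h1 : N 1 = 0 := by nlinarith [sq_nonneg (N 0), sq_nonneg (N 1)]
    rcases sq_eq_sq_iff_eq_or_eq_neg.1 (by linarith : N 2 ^ 2 = 1 ^ 2) with h2 | h2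
    · exact exists_contDiffAt_Pc_north hc0 hc1 h0 h1 h2
    · let σ : EuclideanSpace ℝ (Fin 3) → EuclideanSpace ℝ (Fin 3) := fun u => !₂[u 1, u 0, -u 2]
      have hσ : ContDiff ℝ 2 σ := by
        rw [contDiff_euclidean]
        intro i
        fin_cases i <;> simp only [σ] <;> simp <;> fun_prop
      obtain ⟨Q, hQ, hPQ⟩ := exists_contDiffAt_Pc_north hc0 hc1 (N := σ N)
        (by simp [σ, h1]) (by simp [σ, h0]) (by simp [σ, h2])
      refine ⟨fun u => -Q (σ u), (hQ.comp N hσ.contDiffAt).neg, ?_⟩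
      have hne : ∀ᶠ u in nhds N, u 2 ≠ 0 :=
        ContinuousAt.eventually_ne (g := fun u : EuclideanSpace ℝ (Fin 3) => u 2)
          (by fun_prop) (by simp [h2])
      filter_upwards [hne, hσ.continuous.continuousAt.eventually hPQ] with u hu hPQ hnorm
      rw [← hPQ]
      · exact Pc_swap_neg c (by simp [σ]) (by simp [σ]) (by simp [σ]) hu
      · rw [EuclideanSpace.norm_eq, Fin.sum_univ_three] at hnorm ⊢
        rw [← hnorm]
        simp [σ, add_comm]
  · exact ⟨Pc c, contDiffAt_Pc hc0 hc1 h (by nlinarith) (by nlinarith), .of_forall fun _ _ => rfl⟩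

/-- Lemma 4.5: for `0 < c < 1`, the function `P_c` is a `C²`-function on the smooth
manifold `S²`. -/
theorem stmt_11 (c : ℝ) (hc0 : 0 < c) (hc1 : c < 1) :
    ContMDiff (𝓡 2) 𝓘(ℝ) 2
      (fun u : Metric.sphere (0 : EuclideanSpace ℝ (Fin 3)) 1 => Pc c u) := by
  intro u
  obtain ⟨Q, hQ, hPQ⟩ := exists_contDiffAt_Pc hc0 hc1 (N := u) (by simp)
  have h : ContMDiffAt (𝓡 2) 𝓘(ℝ) 2
      (fun u : Metric.sphere (0 : EuclideanSpace ℝ (Fin 3)) 1 => Q u) u :=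
    ContMDiffAt.comp u (g := Q) hQ.contMDiffAt (contMDiff_coe_sphere u)
  refine h.congr_of_eventuallyEq ?_
  filter_upwards [continuous_subtype_val.continuousAt.eventually hPQ] with w hw
  exact hw (by simp)
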